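/- Let F be an algebraically closed field of characteristic p > 0 and let L be a finite-dimensional transitive irreducible ℤ-graded Lie algebra over F such that the only ideal of L contained in ⊕_{i<0} L_i is zero. Let I be a nonzero ideal of L contained in every nonzero ideal of L (the unique minimal ideal). Then there exist a natural number n ≥ 0 and a finite-dimensional simple Lie algebra S over F such that I is isomorphic, as a Lie algebra over F, to the current algebra S ⊗_F O_n, where O_n = F[x_1,…,x_n]/(x_1^p,…,x_n^p) is the truncated polynomial algebra and the bracket on S ⊗_F O_n is [s⊗f, t⊗g] = [s,t]⊗fg. -/

import Mathlib

open scoped TensorProduct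

/-- The truncated polynomial algebra `O_n = F[x_1, …, x_n] / (x_1^p, …, x_n^p)`. -/
abbrev TruncatedPolynomialAlgebra (F : Type) [Field F] (p n : ℕ) : Type :=
  MvPolynomial (Fin n) F ⧸ Ideal.span (Set.range fun i : Fin n => (MvPolynomial.X i : MvPolynomial (Fin n) F) ^ p)

namespace BlockTheorem

section Exponential

variable {F A R : Type*} [Field F] [LieRing A] [LieAlgebra F A] [CommRing R] [Algebra F R]

/-- The space of derivations of a Lie algebra, as a space of endomorphisms. -/
def derivations (F A : Type*) [Field F] [LieRing A] [LieAlgebra F A] :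
    Submodule F (Module.End F A) where
  carrier := {d | ∀ x y, d ⁅x, y⁆ = ⁅d x, y⁆ + ⁅x, d y⁆}
  zero_mem' := by simp
  add_mem' := by
    intro d e hd he x y
    simp only [LinearMap.add_apply, hd x y, he x y, add_lie, lie_add]
    abel
  smul_mem' := by
    intro c d hd x y
    simp only [LinearMap.smul_apply, hd x y, smul_lie, lie_smul, smul_add]

theorem mem_derivations {d : Module.End F A} :
    d ∈ derivations F A ↔ ∀ x y, d ⁅x, y⁆ = ⁅d x, y⁆ + ⁅x, d y⁆ := Iff.rfl

theorem commutator_mem_derivations {d e : Module.End F A} (hd : d ∈ derivations F A)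
    (he : e ∈ derivations F A) : d * e - e * d ∈ derivations F A := by
  rw [mem_derivations] at *
  intro x y
  simp only [LinearMap.sub_apply, Module.End.mul_apply, hd, he, map_add, sub_lie, lie_sub]
  abel

/-- The Leibniz rule for powers of a derivation. -/
theorem pow_apply_lie {d : Module.End F A} (hd : d ∈ derivations F A) (m : ℕ) (x y : A) :
    (d ^ m) ⁅x, y⁆ = ∑ ij ∈ Finset.HasAntidiagonal.antidiagonal m,
      m.choose ij.1 • ⁅(d ^ ij.1) x, (d ^ ij.2) y⁆ := by
  let D : LieDerivation F A A := ⟨d, fun a b ↦ by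
    rw [hd a b, ← lie_skew b (d a)]; abel⟩
  have h := LieDerivation.iterate_apply_lie D m x y
  have hD : ∀ k z, D^[k] z = (d ^ k) z := fun k z ↦ by
    rw [Module.End.pow_apply]; rfl
  simpa only [hD] using h

theorem pow_char_mem_derivations (p : ℕ) [CharP F p] (hp : p.Prime) {d : Module.End F A}
    (hd : d ∈ derivations F A) : d ^ p ∈ derivations F A := by
  intro x y
  rw [pow_apply_lie hd, Finset.Nat.sum_antidiagonal_eq_sum_range_succ_mk, Finset.sum_range_succ,
    Finset.sum_eq_single_of_mem 0 (by simp [hp.pos])]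
  · simp [add_comm]
  · intro k hk hk0
    rw [← Nat.cast_smul_eq_nsmul F, (CharP.cast_eq_zero_iff F p _).2, zero_smul]
    exact hp.dvd_choose_self hk0 (Finset.mem_range.1 hk)

/-- The truncated exponential `∑_{k < p} tᵏ ⊗ dᵏ / k!` acting on `R ⊗ A`. -/
noncomputable def truncExp (p : ℕ) (t : R) (d : Module.End F A) : Module.End F (R ⊗[F] A) :=
  ∑ k ∈ Finset.range p, ((k.factorial : F)⁻¹) •
    TensorProduct.map (LinearMap.mulLeft F (t ^ k)) (d ^ k)

theorem truncExp_tmul (p : ℕ) (t : R) (d : Module.End F A) (r : R) (x : A) :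
    truncExp p t d (r ⊗ₜ x) = ∑ k ∈ Finset.range p,
      ((k.factorial : F)⁻¹) • ((t ^ k * r) ⊗ₜ[F] (d ^ k) x) := by
  simp [truncExp]

theorem truncExp_lie (p : ℕ) [CharP F p] (hp : p.Prime) {t : R} (ht : t ^ p = 0)
    {d : Module.End F A} (hd : d ∈ derivations F A) (u v : R ⊗[F] A) :
    truncExp p t d ⁅u, v⁆ = ⁅truncExp p t d u, truncExp p t d v⁆ := by
  induction u using TensorProduct.induction_on with
  | zero => simp
  | add u u' hu hu' => simp only [add_lie, map_add, hu, hu']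
  | tmul r x =>
  induction v using TensorProduct.induction_on with
  | zero => simp
  | add v v' hv hv' => simp only [lie_add, map_add, hv, hv']
  | tmul s y =>
  rw [LieAlgebra.ExtendScalars.bracket_tmul, truncExp_tmul, truncExp_tmul, truncExp_tmul]
  have hfact : ∀ k < p, (k.factorial : F) ≠ 0 := fun k hk h ↦ by
    rw [CharP.cast_eq_zero_iff F p, hp.dvd_factorial] at h
    omega
  let f : ℕ × ℕ → R ⊗[F] A := fun ij ↦ ((ij.1.factorial : F)⁻¹ * (ij.2.factorial : F)⁻¹) •
      ((t ^ (ij.1 + ij.2) * (r * s)) ⊗ₜ[F] ⁅(d ^ ij.1) x, (d ^ ij.2) y⁆)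
  have hleft : ∀ m ∈ Finset.range p, ((m.factorial : F)⁻¹) •
      ((t ^ m * (r * s)) ⊗ₜ[F] (d ^ m) ⁅x, y⁆) = ∑ ij ∈ Finset.HasAntidiagonal.antidiagonal m, f ij := by
    intro m hm
    rw [pow_apply_lie hd, TensorProduct.tmul_sum, Finset.smul_sum]
    refine Finset.sum_congr rfl fun ij hij ↦ ?_
    rw [Finset.HasAntidiagonal.mem_antidiagonal] at hij
    rw [Finset.mem_range] at hm
    have hc : ((m.choose ij.1 : ℕ) : F) * (ij.1.factorial * ij.2.factorial) = m.factorial := by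
      rw [← hij, Nat.choose_symm_add, ← mul_assoc, ← Nat.cast_mul, ← Nat.cast_mul]
      congr 1
      have := Nat.add_choose_mul_factorial_mul_factorial ij.1 ij.2
      exact this
    have h1 := hfact _ hm
    have h2 := hfact ij.1 (by omega)
    have h3 := hfact ij.2 (by omega)
    rw [← Nat.cast_smul_eq_nsmul F, TensorProduct.tmul_smul, smul_smul]
    simp only [f, hij]
    congr 1
    field_simp
    rw [← hc]; ring
  rw [Finset.sum_congr rfl hleft, sum_lie_sum]
  have hright : ∀ i ∈ Finset.range p, ∀ j ∈ Finset.range p,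
      ⁅(i.factorial : F)⁻¹ • (t ^ i * r) ⊗ₜ[F] (d ^ i) x,
        (j.factorial : F)⁻¹ • (t ^ j * s) ⊗ₜ[F] (d ^ j) y⁆ = f (i, j) := by
    intro i _ j _
    rw [smul_lie, lie_smul, smul_smul, LieAlgebra.ExtendScalars.bracket_tmul]
    simp only [f]
    congr 2
    ring
  rw [Finset.sum_congr rfl fun i hi ↦ Finset.sum_congr rfl (hright i hi),
    ← Finset.sum_product (f := f)]
  have hf : ∀ ij ∈ Finset.range p ×ˢ Finset.range p, f ij ≠ 0 → ij.1 + ij.2 < p := by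
    intro ij _ hij
    by_contra! hle
    refine hij ?_
    simp only [f]
    rw [pow_eq_zero_of_le hle ht, zero_mul, TensorProduct.zero_tmul, smul_zero]
  rw [← Finset.sum_filter_of_ne hf, ← Finset.sum_fiberwise_of_maps_to
    (g := fun ij : ℕ × ℕ ↦ ij.1 + ij.2) (t := Finset.range p) (by simp)]
  refine Finset.sum_congr rfl fun m hm ↦ Finset.sum_congr ?_ fun _ _ ↦ rfl
  ext ij
  simp only [Finset.HasAntidiagonal.mem_antidiagonal, Finset.mem_filter, Finset.mem_product,
    Finset.mem_range] at *
  omega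

/-- The composition of the truncated exponentials of `t i ⊗ d i`. -/
noncomputable def multiExp (p : ℕ) {n : ℕ} (t : Fin n → R) (d : Fin n → Module.End F A) :
    Module.End F (R ⊗[F] A) :=
  (List.ofFn fun i ↦ truncExp p (t i) (d i)).prod

theorem multiExp_lie (p : ℕ) [CharP F p] (hp : p.Prime) {n : ℕ} {t : Fin n → R}
    (ht : ∀ i, t i ^ p = 0) {d : Fin n → Module.End F A} (hd : ∀ i, d i ∈ derivations F A)
    (u v : R ⊗[F] A) :
    multiExp p t d ⁅u, v⁆ = ⁅multiExp p t d u, multiExp p t d v⁆ := by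
  induction n with
  | zero => simp [multiExp]
  | succ n ih =>
    have := ih (fun i ↦ ht i.succ) (fun i ↦ hd i.succ)
    simp only [multiExp, List.ofFn_succ, List.prod_cons, Module.End.mul_apply] at this ⊢
    rw [this, truncExp_lie p hp (ht 0) (hd 0)]

/-- The ordered monomial `d₁ ^ a₁ * ⋯ * dₙ ^ aₙ`. -/
noncomputable def orderedMonomial {n : ℕ} (d : Fin n → Module.End F A) (a : Fin n → ℕ) :
    Module.End F A :=
  (List.ofFn fun i ↦ d i ^ a i).prod

theorem multiExp_tmul (p : ℕ) {n : ℕ} (t : Fin n → R) (d : Fin n → Module.End F A) (x : A) :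
    multiExp p t d ((1 : R) ⊗ₜ x) = ∑ a : Fin n → Fin p,
      (∏ i, (((a i : ℕ).factorial : F)⁻¹)) •
        ((∏ i, t i ^ (a i : ℕ)) ⊗ₜ[F] orderedMonomial d (fun i ↦ a i) x) := by
  induction n with
  | zero => simp [multiExp, orderedMonomial]
  | succ n ih =>
    have := ih (fun i ↦ t i.succ) (fun i ↦ d i.succ)
    simp only [multiExp, orderedMonomial, List.ofFn_succ, List.prod_cons,
      Module.End.mul_apply] at this ⊢
    rw [this, map_sum, ← (Fin.consEquiv fun _ ↦ Fin p).sum_comp, Fintype.sum_prod_type,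
      Finset.sum_comm]
    refine Finset.sum_congr rfl fun a _ ↦ ?_
    rw [map_smul, truncExp_tmul, Finset.sum_range, Finset.smul_sum]
    refine Finset.sum_congr rfl fun k _ ↦ ?_
    simp [Fin.prod_univ_succ, Fin.consEquiv, smul_smul, mul_comm]

/-- The span of the tensors `r ⊗ x` with `r` in a given ideal. -/
def idealTensor (F A : Type*) {R : Type*} [Field F] [LieRing A] [LieAlgebra F A] [CommRing R]
    [Algebra F R] (m : Ideal R) : Submodule F (R ⊗[F] A) :=
  Submodule.span F {z | ∃ r ∈ m, ∃ x : A, r ⊗ₜ[F] x = z}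

theorem tmul_mem_idealTensor {m : Ideal R} {r : R} (hr : r ∈ m) (x : A) :
    r ⊗ₜ[F] x ∈ idealTensor F A m :=
  Submodule.subset_span ⟨r, hr, x, rfl⟩

theorem truncExp_sub_mem {p : ℕ} (hp : 2 ≤ p) {m : Ideal R} {t : R} (ht : t ∈ m)
    (d : Module.End F A) (r : R) (x : A) :
    truncExp p t d (r ⊗ₜ x) - r ⊗ₜ x - (t * r) ⊗ₜ d x ∈ idealTensor F A (m ^ 2) := by
  obtain ⟨q, rfl⟩ := Nat.exists_eq_add_of_le' hp
  rw [truncExp_tmul, Finset.sum_range_succ', Finset.sum_range_succ']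
  simp only [zero_add, Nat.factorial_zero, Nat.factorial_one, Nat.cast_one, inv_one, one_smul,
    pow_zero, pow_one, one_mul, Module.End.one_apply, add_sub_cancel_right]
  refine Submodule.sum_mem _ fun k _ ↦ Submodule.smul_mem _ _ (tmul_mem_idealTensor ?_ _)
  refine Ideal.mul_mem_right _ _ (Ideal.pow_le_pow_right ?_ (Ideal.pow_mem_pow ht _))
  omega

theorem truncExp_mem {p : ℕ} {m : Ideal R} (t : R) (d : Module.End F A) {z : R ⊗[F] A}
    (hz : z ∈ idealTensor F A m) : truncExp p t d z ∈ idealTensor F A m := by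
  induction hz using Submodule.span_induction with
  | zero => simp
  | add u v _ _ hu hv => rw [map_add]; exact add_mem hu hv
  | smul c u _ hu => rw [map_smul]; exact Submodule.smul_mem _ _ hu
  | mem z hz =>
    obtain ⟨r, hr, x, rfl⟩ := hz
    rw [truncExp_tmul]
    exact Submodule.sum_mem _ fun k _ ↦ Submodule.smul_mem _ _
      (tmul_mem_idealTensor (Ideal.mul_mem_left _ _ hr) _)

/-- The first order approximation of `multiExp`. -/
theorem multiExp_sub_mem {p : ℕ} (hp : 2 ≤ p) {m : Ideal R} {n : ℕ} {t : Fin n → R}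
    (ht : ∀ i, t i ∈ m) (d : Fin n → Module.End F A) (x : A) :
    multiExp p t d ((1 : R) ⊗ₜ x) - (1 : R) ⊗ₜ x - ∑ i, t i ⊗ₜ d i x ∈
      idealTensor F A (m ^ 2) := by
  induction n with
  | zero => simp [multiExp]
  | succ n ih =>
    have h := truncExp_mem (p := p) (t 0) (d 0) (ih (fun i ↦ ht i.succ) (fun i ↦ d i.succ))
    simp only [multiExp, List.ofFn_succ, List.prod_cons, Module.End.mul_apply, map_sub,
      map_sum] at h ⊢
    have h0 := truncExp_sub_mem hp (ht 0) (d 0) 1 x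
    have h1 : ∑ i : Fin n, (truncExp p (t 0) (d 0) (t i.succ ⊗ₜ d i.succ x) -
        t i.succ ⊗ₜ d i.succ x) ∈ idealTensor F A (m ^ 2) := by
      refine Submodule.sum_mem _ fun i _ ↦ ?_
      have := truncExp_sub_mem hp (ht 0) (d 0) (t i.succ) (d i.succ x)
      have h2 : (t 0 * t i.succ) ⊗ₜ[F] d 0 (d i.succ x) ∈ idealTensor F A (m ^ 2) :=
        tmul_mem_idealTensor (by rw [pow_two]; exact Ideal.mul_mem_mul (ht _) (ht _)) _
      simpa using add_mem this h2
    rw [Fin.sum_univ_succ]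
    rw [Finset.sum_sub_distrib] at h1
    rw [mul_one] at h0
    convert add_mem (add_mem h h0) h1 using 1
    abel

end Exponential

section Generation

variable {F A R : Type*} [Field F] [LieRing A] [LieAlgebra F A] [CommRing R] [Algebra F R]

theorem idealTensor_mono {m m' : Ideal R} (h : m ≤ m') :
    idealTensor F A m ≤ idealTensor F A m' :=
  Submodule.span_mono fun _ ⟨r, hr, x, hx⟩ ↦ ⟨r, h hr, x, hx⟩

theorem idealTensor_top : idealTensor F A (⊤ : Ideal R) = ⊤ := by
  rw [eq_top_iff, ← TensorProduct.span_tmul_eq_top]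
  exact Submodule.span_mono fun _ ⟨r, x, hx⟩ ↦ ⟨r, trivial, x, hx⟩

theorem idealTensor_bot : idealTensor F A (⊥ : Ideal R) = ⊥ := by
  rw [idealTensor, Submodule.span_eq_bot]
  rintro _ ⟨r, rfl, x, rfl⟩
  exact TensorProduct.zero_tmul _ _

theorem lie_mem_idealTensor {m m' : Ideal R} {u v : R ⊗[F] A} (hu : u ∈ idealTensor F A m)
    (hv : v ∈ idealTensor F A m') : ⁅u, v⁆ ∈ idealTensor F A (m * m') := by
  induction hu using Submodule.span_induction with
  | zero => simp
  | add u u' _ _ hu hu' => rw [add_lie]; exact add_mem hu hu'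
  | smul c u _ hu => rw [smul_lie]; exact Submodule.smul_mem _ _ hu
  | mem u hu =>
  obtain ⟨r, hr, x, rfl⟩ := hu
  induction hv using Submodule.span_induction with
  | zero => simp
  | add u u' _ _ hu hu' => rw [lie_add]; exact add_mem hu hu'
  | smul c u _ hu => rw [lie_smul]; exact Submodule.smul_mem _ _ hu
  | mem u hu =>
  obtain ⟨r', hr', x', rfl⟩ := hu
  exact tmul_mem_idealTensor (Ideal.mul_mem_mul hr hr') _

/-- A Lie subalgebra of the current algebra `R ⊗ A` over a perfect Lie algebra `A` and a local
algebra `R = F + m` with nilpotent `m` is everything as soon as it is so modulo `m ^ 2`. -/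
theorem eq_top_of_generates_mod_sq {ι : Type*} {t : ι → R}
    (hnil : IsNilpotent (Ideal.span (Set.range t)))
    (hloc : ∀ r : R, ∃ c : F, r - algebraMap F R c ∈ Ideal.span (Set.range t))
    (hperf : Submodule.span F {z : A | ∃ x y : A, ⁅x, y⁆ = z} = ⊤)
    (B : Submodule F (R ⊗[F] A)) (hB : ∀ u ∈ B, ∀ v ∈ B, ⁅u, v⁆ ∈ B)
    (h0 : ∀ x : A, (1 : R) ⊗ₜ x ∈ B ⊔ idealTensor F A (Ideal.span (Set.range t)))
    (h1 : ∀ i, ∀ x : A, t i ⊗ₜ x ∈ B ⊔ idealTensor F A (Ideal.span (Set.range t) ^ 2)) :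
    B = ⊤ := by
  set m := Ideal.span (Set.range t) with hm
  have hone : ∀ r ∈ m, ∀ x : A, r ⊗ₜ[F] x ∈ B ⊔ idealTensor F A (m ^ 2) := by
    intro r hr
    induction hr using Submodule.span_induction with
    | zero => simp
    | add r r' _ _ hr hr' =>
      intro x
      rw [TensorProduct.add_tmul]; exact add_mem (hr x) (hr' x)
    | mem r hr => obtain ⟨i, rfl⟩ := hr; exact h1 i
    | smul a r hrm hr =>
      intro x
      obtain ⟨c, hc⟩ := hloc a
      have h2 : ((a - algebraMap F R c) * r) ⊗ₜ[F] x ∈ idealTensor F A (m ^ 2) :=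
        tmul_mem_idealTensor (by rw [pow_two]; exact Ideal.mul_mem_mul hc hrm) _
      have h3 : (a • r) ⊗ₜ[F] x = r ⊗ₜ[F] (c • x) + ((a - algebraMap F R c) * r) ⊗ₜ[F] x := by
        rw [← TensorProduct.smul_tmul, ← TensorProduct.add_tmul, smul_eq_mul, Algebra.smul_def]
        ring_nf
      rw [h3]
      exact add_mem (hr _) (Submodule.mem_sup_right h2)
  have hk : ∀ k : ℕ, ∀ r ∈ m ^ k, ∀ x : A, r ⊗ₜ[F] x ∈ B ⊔ idealTensor F A (m ^ (k + 1)) := by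
    intro k
    induction k with
    | zero =>
      intro r _ x
      obtain ⟨c, hc⟩ := hloc r
      have h3 : r ⊗ₜ[F] x = (1 : R) ⊗ₜ[F] (c • x) + (r - algebraMap F R c) ⊗ₜ[F] x := by
        rw [← TensorProduct.smul_tmul, ← TensorProduct.add_tmul, Algebra.smul_def]
        ring_nf
      rw [h3, zero_add, pow_one]
      exact add_mem (h0 _) (Submodule.mem_sup_right (tmul_mem_idealTensor hc _))
    | succ k ih =>
      intro r hr x
      have hx : x ∈ Submodule.span F {z : A | ∃ x y : A, ⁅x, y⁆ = z} := hperf ▸ trivial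
      induction hx using Submodule.span_induction with
      | zero => simp
      | add x y _ _ hx hy => rw [TensorProduct.tmul_add]; exact add_mem hx hy
      | smul c x _ hx => rw [TensorProduct.tmul_smul]; exact Submodule.smul_mem _ _ hx
      | mem x hx =>
      obtain ⟨y, z, rfl⟩ := hx
      rw [pow_succ'] at hr
      induction hr using Submodule.mul_induction_on' with
      | add r _ r' _ hr hr' => rw [TensorProduct.add_tmul]; exact add_mem hr hr'
      | mem_mul_mem g hg h hh =>
      rw [← LieAlgebra.ExtendScalars.bracket_tmul]
      obtain ⟨b, hb, u, hu, hbu⟩ := Submodule.mem_sup.1 (hone g hg y)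
      obtain ⟨b', hb', u', hu', hbu'⟩ := Submodule.mem_sup.1 (ih h hh z)
      have hb'm : b' ∈ idealTensor F A (m ^ k) := by
        rw [eq_sub_of_add_eq hbu']
        exact sub_mem (tmul_mem_idealTensor hh _) (idealTensor_mono (Ideal.pow_le_pow_right
          (Nat.le_succ k)) hu')
      have h4 : ⁅g ⊗ₜ[F] y, h ⊗ₜ[F] z⁆ = ⁅b, b'⁆ + (⁅u, b'⁆ + ⁅g ⊗ₜ[F] y, u'⁆) := by
        rw [← hbu', lie_add, ← hbu, add_lie, add_assoc]
      rw [h4]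
      refine Submodule.add_mem_sup (hB _ hb _ hb') (add_mem ?_ ?_)
      · have := lie_mem_idealTensor hu hb'm
        rwa [← pow_add, add_comm 2 k] at this
      · have := lie_mem_idealTensor (tmul_mem_idealTensor hg y) hu'
        rwa [← pow_succ'] at this
  have hstep : ∀ k, idealTensor F A (m ^ k) ≤ B ⊔ idealTensor F A (m ^ (k + 1)) := by
    intro k
    rw [idealTensor, Submodule.span_le]
    rintro _ ⟨r, hr, x, rfl⟩
    exact hk k r hr x
  have hall : ∀ k, B ⊔ idealTensor F A (m ^ k) = ⊤ := by
    intro k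
    induction k with
    | zero => rw [pow_zero, Ideal.one_eq_top, idealTensor_top, sup_top_eq]
    | succ k ih => rw [eq_top_iff, ← ih]; exact sup_le le_sup_left (hstep k)
  obtain ⟨k, hk⟩ := hnil
  have := hall k
  rwa [hk, Submodule.zero_eq_bot, idealTensor_bot, sup_bot_eq] at this

end Generation

section Density

variable {F V : Type*} [Field F] [IsAlgClosed F] [AddCommGroup V] [Module F V]
  [FiniteDimensional F V]

/-- Schur's lemma for an irreducible set of endomorphisms. -/
theorem exists_eq_smul_of_commute {T : Set (Module.End F V)}
    (hT : ∀ W : Submodule F V, (∀ f ∈ T, ∀ w ∈ W, f w ∈ W) → W = ⊥ ∨ W = ⊤)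
    (g : Module.End F V) (hg : ∀ f ∈ T, ∀ v, g (f v) = f (g v)) : ∃ c : F, ∀ v, g v = c • v := by
  rcases subsingleton_or_nontrivial V with hV | hV
  · exact ⟨0, fun v ↦ Subsingleton.elim _ _⟩
  obtain ⟨c, hc⟩ := Module.End.exists_eigenvalue g
  refine ⟨c, fun v ↦ ?_⟩
  rcases hT (Module.End.eigenspace g c) (fun f hf w hw ↦ by
    rw [Module.End.mem_eigenspace_iff] at hw ⊢
    rw [hg f hf, hw, map_smul]) with h | h
  · exact absurd h hc
  · rw [← Module.End.mem_eigenspace_iff, h]; trivial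

/-- The density theorem for an irreducible set of endomorphisms over an algebraically closed
field: a proper stable subspace of `Vⁿ` satisfies a linear relation. -/
theorem eq_top_of_no_relation {T : Set (Module.End F V)}
    (hT : ∀ W : Submodule F V, (∀ f ∈ T, ∀ w ∈ W, f w ∈ W) → W = ⊥ ∨ W = ⊤)
    {n : ℕ} (W : Submodule F (Fin n → V)) (hW : ∀ f ∈ T, ∀ w ∈ W, (fun i ↦ f (w i)) ∈ W)
    (hrel : ∀ c : Fin n → F, (∀ w ∈ W, ∑ i, c i • w i = 0) → c = 0) : W = ⊤ := by
  induction n with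
  | zero => exact Subsingleton.elim _ _
  | succ n ih =>
  let tl : (Fin (n + 1) → V) →ₗ[F] (Fin n → V) := LinearMap.funLeft F V Fin.succ
  have htl : W.map tl = ⊤ := by
    apply ih
    · rintro f hf _ ⟨w, hw, rfl⟩
      exact ⟨_, hW f hf w hw, rfl⟩
    · intro c hc
      have := hrel (Fin.cons 0 c) fun w hw ↦ by
        simpa [Fin.sum_univ_succ, tl, LinearMap.funLeft_apply] using hc (tl w) ⟨w, hw, rfl⟩
      ext i
      simpa using congrFun this i.succ
  have hlift : ∀ u : Fin n → V, ∃ v : V, (Fin.cons v u : Fin (n + 1) → V) ∈ W := by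
    intro u
    obtain ⟨w, hw, rfl⟩ : u ∈ W.map tl := htl ▸ trivial
    exact ⟨w 0, (Fin.cons_self_tail w).symm ▸ hw⟩
  have hzero : ∀ v : V, (Fin.cons v 0 : Fin (n + 1) → V) = LinearMap.single F (fun _ ↦ V) 0 v := by
    intro v
    ext i
    refine Fin.cases ?_ (fun j ↦ ?_) i <;> simp
  rcases hT (W.comap (LinearMap.single F (fun _ ↦ V) 0)) (fun f hf v hv ↦ by
    rw [Submodule.mem_comap, ← hzero] at hv ⊢
    convert hW f hf _ hv using 1
    ext i
    refine Fin.cases ?_ (fun j ↦ ?_) i <;> simp) with h | h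
  · have huniq : ∀ {u : Fin n → V} {v v' : V}, (Fin.cons v u : Fin (n + 1) → V) ∈ W →
        (Fin.cons v' u : Fin (n + 1) → V) ∈ W → v = v' := by
      intro u v v' hv hv'
      have h2 : v - v' ∈ W.comap (LinearMap.single F (fun _ ↦ V) 0) := by
        rw [Submodule.mem_comap, ← hzero]
        convert sub_mem hv hv' using 1
        ext i
        refine Fin.cases ?_ (fun j ↦ ?_) i <;> simp
      rw [h, Submodule.mem_bot] at h2
      exact sub_eq_zero.1 h2
    choose g hg using hlift
    let f : (Fin n → V) →ₗ[F] V :=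
      { toFun := g
        map_add' := fun u u' ↦ huniq (hg _) (by
          convert add_mem (hg u) (hg u') using 1
          ext i
          refine Fin.cases ?_ (fun j ↦ ?_) i <;> simp)
        map_smul' := fun c u ↦ huniq (hg _) (by
          convert W.smul_mem c (hg u) using 1
          ext i
          refine Fin.cases ?_ (fun j ↦ ?_) i <;> simp) }
    have hf : ∀ j, ∃ c : F, ∀ v, f (Pi.single j v) = c • v := fun j ↦
      exists_eq_smul_of_commute hT (f ∘ₗ LinearMap.single F (fun _ ↦ V) j) fun e he v ↦
        huniq (hg _) (by
          convert hW e he _ (hg (Pi.single j v)) using 1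
          ext i
          refine Fin.cases ?_ (fun k ↦ ?_) i
          · simp [f]
          · simp only [Fin.cons_succ, LinearMap.coe_single]
            rw [← Pi.apply_single (fun _ ↦ e) (fun _ ↦ map_zero e)])
    choose c hc using hf
    have h3 := hrel (Fin.cons 1 (-c)) fun w hw ↦ by
      have h4 : w 0 = f (tl w) := huniq (u := tl w)
        ((Fin.cons_self_tail w).symm ▸ hw) (hg _)
      have h5 : f (tl w) = ∑ j, c j • tl w j := by
        conv_lhs => rw [← Finset.univ_sum_single (tl w), map_sum]
        exact Finset.sum_congr rfl fun j _ ↦ hc j _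
      simp only [Fin.sum_univ_succ, Fin.cons_zero, Fin.cons_succ, one_smul, h4, h5]
      simp [tl, LinearMap.funLeft_apply]
    exact absurd (congrFun h3 0) (by simp)
  · rw [eq_top_iff]
    intro v _
    obtain ⟨a, ha⟩ := hlift (tl v)
    have h2 : v 0 - a ∈ W.comap (LinearMap.single F (fun _ ↦ V) 0) := h ▸ trivial
    rw [Submodule.mem_comap, ← hzero] at h2
    convert add_mem h2 ha using 1
    ext i
    refine Fin.cases ?_ (fun j ↦ ?_) i <;> simp [tl, LinearMap.funLeft_apply]

end Density

section Words

variable {F A : Type*} [Field F] [LieRing A] [LieAlgebra F A]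

theorem commutator_mem_one_sup {f g : Module.End F A} (hf : f ∈ 1 ⊔ derivations F A)
    (hg : g ∈ 1 ⊔ derivations F A) : f * g - g * f ∈ 1 ⊔ derivations F A := by
  obtain ⟨a, ha, d, hd, rfl⟩ := Submodule.mem_sup.1 hf
  obtain ⟨b, hb, e, he, rfl⟩ := Submodule.mem_sup.1 hg
  obtain ⟨r, rfl⟩ := Submodule.mem_one.1 ha
  obtain ⟨s, rfl⟩ := Submodule.mem_one.1 hb
  refine Submodule.mem_sup_right ?_
  convert commutator_mem_derivations hd he using 1
  have h1 := Algebra.commutes r e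
  have h2 := Algebra.commutes s d
  have h3 := Algebra.commutes r (algebraMap F (Module.End F A) s)
  rw [mul_add, add_mul, add_mul, mul_add, add_mul, add_mul, h1, h2, h3]
  abel

theorem prod_mem_pow_length {Q : Submodule F (Module.End F A)} {l : List (Module.End F A)}
    (hl : ∀ f ∈ l, f ∈ Q) : l.prod ∈ Q ^ l.length := by
  induction l with
  | nil => exact Submodule.one_le.1 le_rfl
  | cons f l ih =>
    rw [List.prod_cons, List.length_cons, pow_succ']
    exact Submodule.mul_mem_mul (hl f (by simp)) (ih fun g hg ↦ hl g (by simp [hg]))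

theorem pow_mono_of_one_le {Q : Submodule F (Module.End F A)} (hQ : 1 ≤ Q) {a b : ℕ}
    (hab : a ≤ b) : Q ^ a ≤ Q ^ b := by
  induction hab with
  | refl => exact le_rfl
  | step _ ih =>
    refine ih.trans ?_
    rw [pow_succ]
    conv_lhs => rw [← mul_one (Q ^ _)]
    exact Submodule.mul_le.2 fun f hf g hg ↦ Submodule.mul_mem_mul hf (hQ hg)

/-- Permuting the factors changes a product of derivations by shorter products. -/
theorem prod_sub_prod_mem_of_perm {l l' : List (Module.End F A)} (h : l.Perm l')
    (hl : ∀ f ∈ l, f ∈ 1 ⊔ derivations F A) {m : ℕ} (hm : l.length ≤ m + 1) :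
    l.prod - l'.prod ∈ (1 ⊔ derivations F A) ^ m := by
  induction h generalizing m with
  | nil => simp
  | @cons f l l' h ih =>
    rw [List.prod_cons, List.prod_cons, ← mul_sub]
    rcases m with _ | m
    · have h0 : l = [] := by
        rw [← List.length_eq_zero_iff]; simpa using hm
      subst h0
      rw [h.nil_eq]
      simp
    · rw [pow_succ']
      exact Submodule.mul_mem_mul (hl f (by simp))
        (ih (fun g hg ↦ hl g (by simp [hg])) (by simpa using hm))
  | swap f g l =>
    simp only [List.prod_cons, ← mul_assoc, ← sub_mul]
    simp only [List.length_cons] at hm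
    have h1 := Submodule.mul_mem_mul (commutator_mem_one_sup (hl g (by simp)) (hl f (by simp)))
      (prod_mem_pow_length (l := l) fun e he ↦ hl e (by simp [he]))
    rw [← pow_succ'] at h1
    exact pow_mono_of_one_le le_sup_left (by omega) h1
  | trans h h' ih ih' =>
    have := add_mem (ih hl hm) (ih' (fun f hf ↦ hl f (h.mem_iff.2 hf)) (by rwa [← h.length_eq]))
    rwa [sub_add_sub_cancel] at this

/-- A list in a finite ordered alphabet is a permutation of its sorted version. -/
theorem perm_flatten_replicate {n : ℕ} (l : List (Fin n)) :
    l.Perm (List.ofFn fun i ↦ List.replicate (l.count i) i).flatten := by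
  rw [List.perm_iff_count]
  intro i
  rw [List.count_flatten, List.map_ofFn, List.sum_ofFn, Finset.sum_eq_single i]
  · simp
  · intro j _ hj
    simp [List.count_replicate, hj]
  · simp

/-- If all the reduced ordered monomials send `x` into `N` then all products of derivations
do. -/
theorem pow_apply_mem_of_orderedMonomial_mem (p : ℕ) [CharP F p] (hp : p.Prime)
    {N : Submodule F A} {n : ℕ} {d : Fin n → Module.End F A} (hd : ∀ i, d i ∈ derivations F A)
    (hspan : derivations F A ≤ Submodule.span F
      ({e | e ∈ derivations F A ∧ ∀ x ∈ N, e x ∈ N} ∪ Set.range d))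
    {x : A} (hx : ∀ a : Fin n → Fin p, orderedMonomial d (fun i ↦ a i) x ∈ N) (k : ℕ) :
    ∀ f ∈ (1 ⊔ derivations F A) ^ k, f x ∈ N := by
  classical
  have hp0 : NeZero p := ⟨hp.ne_zero⟩
  induction k with
  | zero =>
    intro f hf
    rw [pow_zero, Submodule.mem_one] at hf
    obtain ⟨c, rfl⟩ := hf
    have := hx 0
    simp only [orderedMonomial, Pi.zero_apply, Fin.val_zero, pow_zero] at this
    simpa [Algebra.algebraMap_eq_smul_one] using N.smul_mem c this
  | succ k ih =>
  set G : Set (Module.End F A) :=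
    {e | e ∈ derivations F A ∧ ∀ x ∈ N, e x ∈ N} ∪ Set.range d with hG
  have hGder : ∀ g ∈ insert 1 G, g ∈ 1 ⊔ derivations F A := by
    rintro g (rfl | ⟨hg, _⟩ | ⟨i, rfl⟩)
    · exact Submodule.mem_sup_left (Submodule.one_le.1 le_rfl)
    · exact Submodule.mem_sup_right hg
    · exact Submodule.mem_sup_right (hd i)
  have hperm : ∀ {l l' : List (Module.End F A)}, l.Perm l' → (∀ g ∈ l, g ∈ insert 1 G) →
      l.length ≤ k + 1 → l'.prod x ∈ N → l.prod x ∈ N := by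
    intro l l' h hl hlen hl'
    have := ih _ (prod_sub_prod_mem_of_perm h (fun f hf ↦ hGder f (hl f hf)) hlen)
    rw [LinearMap.sub_apply] at this
    simpa using add_mem this hl'
  have hword : ∀ l : List (Module.End F A), (∀ g ∈ l, g ∈ insert 1 G) → l.length = k + 1 →
      l.prod x ∈ N := by
    intro l hl hlen
    have hrest : ∀ g ∈ l, (l.erase g).prod x ∈ N := by
      intro g hg
      apply ih
      have h1 : (l.erase g).length = k := by rw [List.length_erase_of_mem hg, hlen]; rfl
      rw [← h1]
      exact prod_mem_pow_length fun f hf ↦ hGder f (hl f (List.mem_of_mem_erase hf))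
    by_cases h : ∃ g ∈ l, ∀ y ∈ N, g y ∈ N
    · obtain ⟨g, hg, hgN⟩ := h
      refine hperm (List.perm_cons_erase hg) hl hlen.le ?_
      rw [List.prod_cons]
      exact hgN _ (hrest g hg)
    · push Not at h
      have hrange : l ∈ Set.range (List.map d) := by
        rw [Set.range_list_map]
        intro g hg
        rcases hl g hg with rfl | ⟨_, hgN⟩ | hg'
        · obtain ⟨y, hy, hy'⟩ := h _ hg
          exact absurd hy hy'
        · obtain ⟨y, hy, hy'⟩ := h _ hg
          exact absurd (hgN y hy) hy'
        · exact hg'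
      obtain ⟨idx, rfl⟩ := hrange
      by_cases hcount : ∀ i, idx.count i < p
      · refine hperm ((perm_flatten_replicate idx).map d) hl hlen.le ?_
        have := hx fun i ↦ ⟨idx.count i, hcount i⟩
        rw [List.map_flatten, List.map_ofFn, List.prod_flatten, List.map_ofFn]
        simpa [orderedMonomial, Function.comp_def] using this
      · push Not at hcount
        obtain ⟨i, hi⟩ := hcount
        obtain ⟨rest, hrest⟩ :=
          (List.replicate_sublist_iff.2 hi).exists_perm_append
        have hrest' := hrest.map d
        refine hperm hrest' hl hlen.le (ih _ ?_)
        have hlen' := hrest.length_eq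
        rw [List.length_map] at hlen
        rw [List.length_append, List.length_replicate, hlen] at hlen'
        have h2 := hp.two_le
        have h3 := Submodule.mul_mem_mul
          (Submodule.mem_sup_right (S := 1) (pow_char_mem_derivations p hp (hd i)))
          (prod_mem_pow_length (Q := 1 ⊔ derivations F A) (l := rest.map d) fun f hf ↦ by
            obtain ⟨j, _, rfl⟩ := List.mem_map.1 hf
            exact Submodule.mem_sup_right (hd j))
        rw [← pow_succ', List.length_map] at h3
        rw [List.map_append, List.prod_append, List.map_replicate, List.prod_replicate]
        exact pow_mono_of_one_le le_sup_left (by omega) h3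
  have hle : (1 ⊔ derivations F A) ^ (k + 1) ≤ N.comap (LinearMap.applyₗ x) := by
    have h1 : 1 ⊔ derivations F A ≤ Submodule.span F (insert 1 G) := by
      refine sup_le ?_ (hspan.trans (Submodule.span_mono (Set.subset_insert _ _)))
      rw [Submodule.one_le]
      exact Submodule.subset_span (Set.mem_insert _ _)
    have h2 : (1 ⊔ derivations F A) ^ (k + 1) ≤ Submodule.span F (insert 1 G) ^ (k + 1) :=
      pow_le_pow_left' h1 _
    refine h2.trans ?_
    rw [Submodule.span_pow, Submodule.span_le]
    intro f hf
    obtain ⟨g, rfl⟩ := Set.mem_pow.1 hf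
    exact hword _ (fun e he ↦ by
      obtain ⟨i, rfl⟩ := (List.mem_ofFn' _ _).1 he
      exact (g i).2) (List.length_ofFn)
  exact fun f hf ↦ hle hf

end Words

section Truncated

variable {F : Type} [Field F] {p n : ℕ}

/-- The image of the variable `X i` in the truncated polynomial algebra. -/
noncomputable def truncX (F : Type) [Field F] (p : ℕ) {n : ℕ} (i : Fin n) :
    TruncatedPolynomialAlgebra F p n :=
  Ideal.Quotient.mk _ (MvPolynomial.X i)

theorem truncX_pow (i : Fin n) : truncX F p i ^ p = 0 := by
  rw [truncX, ← map_pow, Ideal.Quotient.eq_zero_iff_mem]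
  exact Ideal.subset_span ⟨i, rfl⟩

theorem isNilpotent_span_truncX :
    IsNilpotent (Ideal.span (Set.range (truncX F p : Fin n → _))) := by
  rw [Ideal.FG.isNilpotent_iff_le_nilradical (Submodule.fg_span (Set.finite_range _)),
    Ideal.span_le]
  rintro _ ⟨i, rfl⟩
  exact ⟨p, truncX_pow i⟩

theorem exists_sub_algebraMap_mem (r : TruncatedPolynomialAlgebra F p n) :
    ∃ c : F, r - algebraMap F _ c ∈ Ideal.span (Set.range (truncX F p : Fin n → _)) := by
  obtain ⟨f, rfl⟩ := Ideal.Quotient.mk_surjective r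
  induction f using MvPolynomial.induction_on with
  | C c => exact ⟨c, by
    rw [show Ideal.Quotient.mk _ (MvPolynomial.C c) - algebraMap F _ c = 0 from sub_self _]
    exact zero_mem _⟩
  | add f g hf hg =>
    obtain ⟨c, hc⟩ := hf
    obtain ⟨e, he⟩ := hg
    refine ⟨c + e, ?_⟩
    rw [map_add, map_add, add_sub_add_comm]
    exact add_mem hc he
  | mul_X f i _ =>
    refine ⟨0, ?_⟩
    rw [map_zero, sub_zero, map_mul]
    exact Ideal.mul_mem_left _ _ (Ideal.subset_span ⟨i, rfl⟩)

/-- The reduced monomials have coordinate functionals. -/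
theorem exists_coeff (a : Fin n → Fin p) :
    ∃ l : TruncatedPolynomialAlgebra F p n →ₗ[F] F, ∀ b : Fin n → Fin p,
      l (∏ i, truncX F p i ^ (b i : ℕ)) = if b = a then 1 else 0 := by
  classical
  let s : (Fin n → Fin p) → (Fin n →₀ ℕ) := fun b ↦ Finsupp.equivFunOnFinite.symm fun i ↦ b i
  set J : Ideal (MvPolynomial (Fin n) F) :=
    Ideal.span (Set.range fun i : Fin n ↦ (MvPolynomial.X i : MvPolynomial (Fin n) F) ^ p) with hJ
  have hker : J.restrictScalars F ≤ LinearMap.ker (MvPolynomial.lcoeff F (s a)) := by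
    intro f hf
    have h1 : J = Ideal.span ((fun m ↦ MvPolynomial.monomial m (1 : F)) ''
        Set.range fun i : Fin n ↦ Finsupp.single i p) := by
      rw [hJ, ← Set.range_comp]
      congr 2
      ext1 i
      simp [MvPolynomial.X_pow_eq_monomial]
    rw [Submodule.restrictScalars_mem, h1, MvPolynomial.mem_ideal_span_monomial_image] at hf
    rw [LinearMap.mem_ker, MvPolynomial.lcoeff_apply]
    by_contra hne
    obtain ⟨_, ⟨i, rfl⟩, hle⟩ := hf (s a) (MvPolynomial.mem_support_iff.2 hne)
    have h2 := hle i
    simp only [Finsupp.single_eq_same] at h2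
    exact absurd (a i).2 (not_lt.2 h2)
  refine ⟨(Submodule.liftQ _ _ hker) ∘ₗ
    (Submodule.Quotient.restrictScalarsEquiv F J).symm.toLinearMap, fun b ↦ ?_⟩
  have h3 : (∏ i, truncX F p i ^ (b i : ℕ) : TruncatedPolynomialAlgebra F p n) =
      Submodule.Quotient.mk (MvPolynomial.monomial (s b) (1 : F)) := by
    rw [MvPolynomial.monomial_eq, Finsupp.prod_fintype _ _ (by simp)]
    simp only [truncX, ← map_pow, ← map_prod, map_one, one_mul]
    rfl
  rw [h3, LinearMap.comp_apply, LinearEquiv.coe_coe,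
    Submodule.Quotient.restrictScalarsEquiv_symm_mk, Submodule.liftQ_apply,
    MvPolynomial.lcoeff_apply, MvPolynomial.coeff_monomial]
  have h4 : s b = s a ↔ b = a := by
    refine ⟨fun h ↦ ?_, fun h ↦ h ▸ rfl⟩
    ext i
    exact DFunLike.congr_fun h i
  simp only [h4]

end Truncated

section Block

variable {F A : Type*} [Field F] [LieRing A] [LieAlgebra F A]

/-- The span of all brackets. -/
def bracketSpan (F A : Type*) [Field F] [LieRing A] [LieAlgebra F A] : Submodule F A :=
  Submodule.span F {z | ∃ x y : A, ⁅x, y⁆ = z}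

theorem bracketSpan_eq_top (hna : ¬ IsLieAbelian A)
    (hsimple : ∀ W : Submodule F A, (∀ d ∈ derivations F A, ∀ w ∈ W, d w ∈ W) → W = ⊥ ∨ W = ⊤) :
    bracketSpan F A = ⊤ := by
  refine (hsimple (bracketSpan F A) fun d hd w _ ↦ ?_).resolve_left fun h ↦ hna ⟨fun x y ↦ ?_⟩
  · rename_i hw
    induction hw using Submodule.span_induction with
    | zero => simp
    | add u v _ _ hu hv => rw [map_add]; exact add_mem hu hv
    | smul c u _ hu => rw [map_smul]; exact Submodule.smul_mem _ _ hu
    | mem z hz =>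
      obtain ⟨x, y, rfl⟩ := hz
      rw [hd x y]
      exact add_mem (Submodule.subset_span ⟨_, _, rfl⟩) (Submodule.subset_span ⟨_, _, rfl⟩)
  · have h1 : ⁅x, y⁆ ∈ bracketSpan F A := Submodule.subset_span ⟨x, y, rfl⟩
    rwa [h, Submodule.mem_bot] at h1

theorem bracketSpan_quotient_eq_top (h : bracketSpan F A = ⊤) (N : LieIdeal F A) :
    bracketSpan F (A ⧸ N) = ⊤ := by
  rw [eq_top_iff]
  intro z _
  obtain ⟨x, rfl⟩ := LieSubmodule.Quotient.surjective_mk' N z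
  have hx : x ∈ bracketSpan F A := h ▸ trivial
  induction hx using Submodule.span_induction with
  | zero => simp
  | add u v _ _ hu hv => rw [map_add]; exact add_mem (hu trivial) (hv trivial)
  | smul c u _ hu => rw [map_smul]; exact Submodule.smul_mem _ _ (hu trivial)
  | mem z hz =>
    obtain ⟨x, y, rfl⟩ := hz
    exact Submodule.subset_span ⟨LieSubmodule.Quotient.mk' N x, LieSubmodule.Quotient.mk' N y, rfl⟩

/-- The quotient of a perfect Lie algebra by a maximal ideal is simple. -/
theorem isSimple_quotient (h : bracketSpan F A = ⊤) {N : LieIdeal F A} (hN : IsCoatom N) :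
    LieAlgebra.IsSimple F (A ⧸ N) where
  eq_bot_or_eq_top I := by
    let J : LieIdeal F A :=
      { I.toSubmodule.comap (LieSubmodule.Quotient.mk' N).toLinearMap with
        lie_mem := fun {x m} hm ↦ lie_mem_right F (A ⧸ N) I (LieSubmodule.Quotient.mk' N x)
          (LieSubmodule.Quotient.mk' N m) hm }
    have hNJ : N ≤ J := fun x hx ↦ by
      change LieSubmodule.Quotient.mk' N x ∈ I
      rw [(LieSubmodule.Quotient.mk_eq_zero (N := N)).2 hx]
      exact I.zero_mem
    rcases hN.le_iff.1 hNJ with hJ | hJ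
    · refine Or.inr (eq_top_iff.2 fun z _ ↦ ?_)
      obtain ⟨x, rfl⟩ := LieSubmodule.Quotient.surjective_mk' N z
      exact (hJ ▸ LieSubmodule.mem_top x : x ∈ J)
    · refine Or.inl (eq_bot_iff.2 fun z hz ↦ ?_)
      obtain ⟨x, rfl⟩ := LieSubmodule.Quotient.surjective_mk' N z
      have hx : x ∈ J := hz
      rw [hJ] at hx
      exact (LieSubmodule.mem_bot _).2 ((LieSubmodule.Quotient.mk_eq_zero (N := N)).2 hx)
  non_abelian hab := by
    refine hN.1 (eq_top_iff.2 fun x _ ↦ ?_)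
    have hx : x ∈ bracketSpan F A := h ▸ trivial
    have hle : bracketSpan F A ≤ N.toSubmodule := by
      rw [bracketSpan, Submodule.span_le]
      rintro _ ⟨x, y, rfl⟩
      exact (LieSubmodule.Quotient.mk_eq_zero (N := N)).1
        (hab.trivial (LieSubmodule.Quotient.mk' N x) (LieSubmodule.Quotient.mk' N y))
    exact hle hx

/-- A complement of a subspace `D₀` of `D`, given by a basis. -/
theorem exists_complement_basis {V : Type*} [AddCommGroup V] [Module F V] [FiniteDimensional F V]
    (D D₀ : Submodule F V) :
    ∃ (n : ℕ) (d : Fin n → V), (∀ i, d i ∈ D) ∧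
      D ≤ Submodule.span F ((D ⊓ D₀ : Submodule F V) ∪ Set.range d) ∧
      ∀ c : Fin n → F, ∑ i, c i • d i ∈ D₀ → c = 0 := by
  let E : Submodule F D := D₀.comap D.subtype
  let b := Module.finBasis F (D ⧸ E)
  choose d hd using fun i ↦ E.mkQ_surjective (b i)
  refine ⟨_, fun i ↦ d i, fun i ↦ (d i).2, fun v hv ↦ ?_, fun c hc ↦ ?_⟩
  · have h1 : (⟨v, hv⟩ : D) - ∑ i, b.repr (E.mkQ ⟨v, hv⟩) i • d i ∈ E := by
      refine (Submodule.Quotient.mk_eq_zero E).1 ?_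
      change E.mkQ _ = 0
      rw [map_sub, map_sum]
      simp only [map_smul, hd]
      rw [b.sum_repr, sub_self]
    rw [Submodule.span_union, Submodule.span_eq]
    refine Submodule.mem_sup.2 ⟨v - ∑ i, b.repr (E.mkQ ⟨v, hv⟩) i • (d i : V), ⟨?_, ?_⟩,
      ∑ i, b.repr (E.mkQ ⟨v, hv⟩) i • (d i : V), ?_, by simp⟩
    · exact sub_mem hv (Submodule.sum_mem _ fun i _ ↦ Submodule.smul_mem _ _ (d i).2)
    · have h2 : D.subtype _ ∈ D₀ := h1
      simpa using h2
    · exact Submodule.sum_mem _ fun i _ ↦ Submodule.smul_mem _ _ (Submodule.subset_span ⟨i, rfl⟩)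
  · have h1 : ∑ i, c i • d i ∈ E := by
      change D.subtype _ ∈ D₀
      simpa using hc
    have h2 : E.mkQ (∑ i, c i • d i) = 0 := (Submodule.Quotient.mk_eq_zero E).2 h1
    rw [map_sum] at h2
    simp only [map_smul, hd] at h2
    ext i
    exact Fintype.linearIndependent_iff.1 b.linearIndependent c h2 i

theorem lTensor_lie {S R : Type*} [LieRing S] [LieAlgebra F S] [CommRing R] [Algebra F R]
    (π : A →ₗ[F] S) (hπ : ∀ x y, π ⁅x, y⁆ = ⁅π x, π y⁆) (u v : R ⊗[F] A) :
    π.lTensor R ⁅u, v⁆ = ⁅π.lTensor R u, π.lTensor R v⁆ := by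
  induction u using TensorProduct.induction_on with
  | zero => simp
  | add u u' hu hu' => simp only [add_lie, map_add, hu, hu']
  | tmul r x =>
  induction v using TensorProduct.induction_on with
  | zero => simp
  | add v v' hv hv' => simp only [lie_add, map_add, hv, hv']
  | tmul s y => simp [hπ]

end Block

/-- A differentiably simple Lie algebra with a surjection onto a simple Lie algebra `S` is a
current algebra over `S`. -/
theorem exists_equiv_of_surjective {F A S : Type} [Field F] [IsAlgClosed F] [LieRing A]
    [LieAlgebra F A] [LieRing S] [LieAlgebra F S] [FiniteDimensional F S]
    (p : ℕ) [CharP F p] (hp : p.Prime) [FiniteDimensional F A]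
    (hsimple : ∀ W : Submodule F A,
      (∀ d ∈ derivations F A, ∀ w ∈ W, d w ∈ W) → W = ⊥ ∨ W = ⊤)
    (hS : LieAlgebra.IsSimple F S) (hperf : bracketSpan F S = ⊤)
    {π : A →ₗ[F] S} (hπlie : ∀ x y, π ⁅x, y⁆ = ⁅π x, π y⁆) (hπsurj : Function.Surjective π) :
    ∃ (n : ℕ) (e : A ≃ₗ[F] (TruncatedPolynomialAlgebra F p n ⊗[F] S)),
      ∀ x y : A, e ⁅x, y⁆ = ⁅e x, e y⁆ := by
  set N : Submodule F A := LinearMap.ker π with hNdef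
  have hπ : ∀ x, π x = 0 ↔ x ∈ N := fun x ↦ LinearMap.mem_ker.symm
  have hNtop : N ≠ ⊤ := fun h ↦ hS.non_abelian ⟨fun x y ↦ by
    obtain ⟨x, rfl⟩ := hπsurj x
    rw [(hπ x).2 (h ▸ trivial), zero_lie]⟩
  let D₀ : Submodule F (Module.End F A) :=
    { carrier := {d | ∀ x ∈ N, d x ∈ N}
      zero_mem' := fun x _ ↦ N.zero_mem
      add_mem' := fun ha hb x hx ↦ N.add_mem (ha x hx) (hb x hx)
      smul_mem' := fun c _ ha x hx ↦ N.smul_mem c (ha x hx) }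
  obtain ⟨n, d, hd, hspan, hindep⟩ := exists_complement_basis (derivations F A) D₀
  let t : Fin n → TruncatedPolynomialAlgebra F p n := truncX F p
  let φ : A →ₗ[F] TruncatedPolynomialAlgebra F p n ⊗[F] S :=
    π.lTensor _ ∘ₗ multiExp p t d ∘ₗ TensorProduct.mk F (TruncatedPolynomialAlgebra F p n) A 1
  have hφlie : ∀ x y, φ ⁅x, y⁆ = ⁅φ x, φ y⁆ := by
    intro x y
    simp only [φ, LinearMap.comp_apply, TensorProduct.mk_apply]
    rw [← lTensor_lie π hπlie, ← multiExp_lie p hp truncX_pow hd, LieAlgebra.ExtendScalars.bracket_tmul, one_mul]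
  have hinj : Function.Injective φ := by
    rw [← LinearMap.ker_eq_bot]
    let K : Submodule F A :=
      { carrier := {x | ∀ k, ∀ f ∈ (1 ⊔ derivations F A) ^ k, f x ∈ N}
        zero_mem' := fun k f _ ↦ by rw [map_zero]; exact N.zero_mem
        add_mem' := fun ha hb k f hf ↦ by
          rw [map_add]; exact N.add_mem (ha k f hf) (hb k f hf)
        smul_mem' := fun c x hx k f hf ↦ by
          rw [map_smul]; exact N.smul_mem c (hx k f hf) }
    have hKN : ∀ x ∈ K, x ∈ N := fun x hx ↦
      hx 0 1 (by rw [pow_zero]; exact Submodule.one_le.1 le_rfl)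
    have hK : K = ⊥ := by
      refine (hsimple K fun e he w hw k f hf ↦ ?_).resolve_right fun h ↦ hNtop ?_
      · have := Submodule.mul_mem_mul hf (Submodule.mem_sup_right (S := 1) he)
        rw [← pow_succ] at this
        exact hw _ _ this
      · exact eq_top_iff.2 fun x _ ↦ hKN x (h ▸ trivial)
    rw [eq_bot_iff, ← hK]
    intro x hx
    refine pow_apply_mem_of_orderedMonomial_mem p hp (N := N) hd hspan fun a ↦ ?_
    obtain ⟨l, hl⟩ := exists_coeff (F := F) a
    have h1 := congrArg ((TensorProduct.lid F S).toLinearMap ∘ₗ l.rTensor S) (LinearMap.mem_ker.1 hx)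
    simp only [φ, LinearMap.comp_apply, TensorProduct.mk_apply, multiExp_tmul, map_sum,
      map_smul, LinearMap.lTensor_tmul, LinearMap.rTensor_tmul, map_zero, t, hl,
      LinearEquiv.coe_coe, TensorProduct.lid_tmul, ite_smul, one_smul, zero_smul, smul_ite,
      smul_zero, Finset.sum_ite_eq', Finset.mem_univ, if_true] at h1
    refine  ((smul_eq_zero.1 h1).resolve_left ?_)
    refine Finset.prod_ne_zero_iff.2 fun i _ ↦ inv_ne_zero fun h ↦ ?_
    rw [CharP.cast_eq_zero_iff F p, hp.dvd_factorial] at h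
    exact absurd (a i).2 (not_lt.2 h)
  have hφapprox : ∀ x, φ x - (1 : TruncatedPolynomialAlgebra F p n) ⊗ₜ π x - ∑ i, t i ⊗ₜ π (d i x) ∈
      idealTensor F S (Ideal.span (Set.range t) ^ 2) := by
    intro x
    have h1 := multiExp_sub_mem hp.two_le (fun i ↦ Ideal.subset_span (Set.mem_range_self i) :
      ∀ i, t i ∈ Ideal.span (Set.range t)) d x
    have h2 : idealTensor F A (Ideal.span (Set.range t) ^ 2) ≤
        (idealTensor F S (Ideal.span (Set.range t) ^ 2)).comap (π.lTensor _) := by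
      rw [idealTensor, Submodule.span_le]
      rintro _ ⟨r, hr, y, rfl⟩
      exact tmul_mem_idealTensor hr _
    simpa [φ] using h2 h1
  have hsurj : LinearMap.range φ = ⊤ := by
    refine eq_top_of_generates_mod_sq isNilpotent_span_truncX exists_sub_algebraMap_mem
      hperf _ ?_ ?_ ?_
    · rintro _ ⟨x, rfl⟩ _ ⟨y, rfl⟩
      exact ⟨_, hφlie x y⟩
    · intro s
      obtain ⟨x, rfl⟩ := hπsurj s
      have h1 := idealTensor_mono (Ideal.pow_le_self two_ne_zero) (hφapprox x)
      have h2 : ∑ i, t i ⊗ₜ π (d i x) ∈ idealTensor F S (Ideal.span (Set.range t)) :=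
        Submodule.sum_mem _ fun i _ ↦
          tmul_mem_idealTensor (Ideal.subset_span (Set.mem_range_self i)) _
      have h3 := Submodule.sub_mem _ (Submodule.mem_sup_left (LinearMap.mem_range_self φ x))
        (Submodule.mem_sup_right (add_mem h1 h2))
      convert h3 using 1
      abel
    · intro i s
      let δ : A →ₗ[F] Fin n → S := LinearMap.pi fun i ↦ π ∘ₗ d i
      have hW : N.map δ = ⊤ := by
        refine eq_top_of_no_relation (T := Set.range (LieAlgebra.ad F S)) ?_ _ ?_ ?_
        · intro W hW
          let J : LieIdeal F S := { W with lie_mem := fun {x m} hm ↦ hW _ ⟨x, rfl⟩ m hm }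
          rcases hS.eq_bot_or_eq_top J with h | h
          · exact Or.inl (congrArg LieSubmodule.toSubmodule h)
          · exact Or.inr (congrArg LieSubmodule.toSubmodule h)
        · rintro _ ⟨z, rfl⟩ _ ⟨x, hx, rfl⟩
          obtain ⟨y, rfl⟩ := hπsurj z
          refine ⟨⁅y, x⁆, ?_, funext fun j ↦ ?_⟩
          · change π x = 0 at hx
            change π ⁅y, x⁆ = 0
            rw [hπlie, hx, lie_zero]
          have h1 : π (d j ⁅y, x⁆) = ⁅π (d j y), π x⁆ + ⁅π y, π (d j x)⁆ := by
            rw [hd j, map_add, hπlie, hπlie]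
          rw [(hπ x).2 hx, lie_zero, zero_add] at h1
          exact h1
        · intro c hc
          refine hindep c fun x hx ↦ ?_
          have := hc (δ x) ⟨x, hx, rfl⟩
          rw [← hπ]
          simpa [δ] using this
      obtain ⟨x, hx, hxs⟩ : Pi.single i s ∈ N.map δ := hW ▸ trivial
      have h1 := hφapprox x
      have h2 : ∑ j, t j ⊗ₜ[F] π (d j x) = t i ⊗ₜ s := by
        rw [Finset.sum_eq_single i]
        · rw [show π (d i x) = s by simpa [δ] using congrFun hxs i]
        · intro j _ hj
          rw [show π (d j x) = 0 by simpa [δ, hj] using congrFun hxs j, TensorProduct.tmul_zero]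
        · simp
      rw [(hπ x).2 hx, TensorProduct.tmul_zero, sub_zero, h2] at h1
      have h3 := Submodule.sub_mem _ (Submodule.mem_sup_left (LinearMap.mem_range_self φ x))
        (Submodule.mem_sup_right h1)
      rwa [sub_sub_cancel] at h3
  exact ⟨n, LinearEquiv.ofBijective φ ⟨hinj, LinearMap.range_eq_top.1 hsurj⟩, hφlie⟩

/-- Block's theorem for Lie algebras: a finite-dimensional differentiably simple Lie algebra over
an algebraically closed field of positive characteristic is a current algebra. -/
theorem exists_equiv_current {F A : Type} [Field F] [IsAlgClosed F] [LieRing A] [LieAlgebra F A]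
    (p : ℕ) [CharP F p] (hp : p.Prime) [FiniteDimensional F A] (hna : ¬ IsLieAbelian A)
    (hsimple : ∀ W : Submodule F A,
      (∀ d ∈ derivations F A, ∀ w ∈ W, d w ∈ W) → W = ⊥ ∨ W = ⊤) :
    ∃ (n : ℕ) (S : Type) (_ : LieRing S) (_ : LieAlgebra F S),
      FiniteDimensional F S ∧ LieAlgebra.IsSimple F S ∧
      ∃ e : A ≃ₗ[F] (TruncatedPolynomialAlgebra F p n ⊗[F] S), ∀ x y : A, e ⁅x, y⁆ = ⁅e x, e y⁆ := by
  have hperf := bracketSpan_eq_top hna hsimple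
  have hnt : Nontrivial (LieIdeal F A) := by
    refine ⟨⊥, ⊤, fun h ↦ hna ⟨fun x y ↦ ?_⟩⟩
    have : ⁅x, y⁆ ∈ (⊥ : LieIdeal F A) := h ▸ LieSubmodule.mem_top _
    exact (LieSubmodule.mem_bot _).1 this
  obtain ⟨N, hN, -⟩ := (eq_top_or_exists_le_coatom (⊥ : LieIdeal F A)).resolve_left bot_ne_top
  have hS : LieAlgebra.IsSimple F (A ⧸ N) := isSimple_quotient hperf hN
  obtain ⟨n, e, he⟩ := exists_equiv_of_surjective p hp hsimple hS
    (bracketSpan_quotient_eq_top hperf N) (π := (LieSubmodule.Quotient.mk' N).toLinearMap)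
    (fun _ _ ↦ rfl) (LieSubmodule.Quotient.surjective_mk' N)
  exact ⟨n, A ⧸ N, inferInstance, inferInstance, inferInstanceAs (FiniteDimensional F (A ⧸ N)),
    hS, e, he⟩

end BlockTheorem

namespace GradedLieAlgebra

variable {F L : Type*} [Field F] [LieRing L] [LieAlgebra F L] {G : ℤ → Submodule F L}

/-- The sum of all homogeneous components of degree less than `k`. -/
def below (G : ℤ → Submodule F L) (k : ℤ) : Submodule F L := ⨆ i < k, G i

theorem le_below {i k : ℤ} (h : i < k) : G i ≤ below G k := le_iSup₂_of_le i h le_rfl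

theorem below_mono {k l : ℤ} (h : k ≤ l) : below G k ≤ below G l :=
  iSup₂_le fun _ hi ↦ le_below (hi.trans_le h)

theorem below_add_one_le (k : ℤ) : below G (k + 1) ≤ G k ⊔ below G k := by
  refine iSup₂_le fun i hi ↦ ?_
  rcases (Int.lt_add_one_iff.1 hi).eq_or_lt with rfl | h
  · exact le_sup_left
  · exact (le_below h).trans le_sup_right

theorem exists_mem_below (h : iSup G = ⊤) (x : L) : ∃ k, x ∈ below G k := by
  have hx : x ∈ iSup G := h ▸ trivial
  induction hx using Submodule.iSup_induction' with
  | mem i x hx => exact ⟨i + 1, le_below (lt_add_one i) hx⟩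
  | zero => exact ⟨0, zero_mem _⟩
  | add x y _ _ hx hy =>
    obtain ⟨k, hk⟩ := hx
    obtain ⟨l, hl⟩ := hy
    exact ⟨max k l, add_mem (below_mono (le_max_left _ _) hk) (below_mono (le_max_right _ _) hl)⟩

theorem eq_zero_of_mem_below (h : iSupIndep G) {k : ℤ} {x : L} (hx : x ∈ G k)
    (hx' : x ∈ below G k) : x = 0 := by
  refine Submodule.disjoint_def.1 (h k) x hx ?_
  exact (iSup₂_le fun i hi ↦ le_iSup₂_of_le i hi.ne le_rfl : below G k ≤ ⨆ j ≠ k, G j) hx'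

theorem lie_mem_below (hG : ∀ i j : ℤ, ∀ x ∈ G i, ∀ y ∈ G j, ⁅x, y⁆ ∈ G (i + j)) {a b c : ℤ}
    (hc : a + b ≤ c + 1) {x y : L} (hx : x ∈ below G a) (hy : y ∈ below G b) :
    ⁅x, y⁆ ∈ below G c := by
  let T : L →ₗ[F] L →ₗ[F] L :=
    LinearMap.mk₂ F (fun x y ↦ ⁅x, y⁆) add_lie smul_lie lie_add fun c x y ↦ lie_smul c x y
  have h1 : below G a ≤ ((below G c).comap (T.flip y)) := by
    refine iSup₂_le fun i hi x hx ↦ ?_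
    have h2 : below G b ≤ ((below G c).comap (T x)) :=
      iSup₂_le fun j hj y hy ↦ le_below (by omega : i + j < c) (hG i j x hx y hy)
    exact h2 hy
  exact h1 hx

/-- Leading components in degree `k` of elements of the ideal `I`. -/
def leading (G : ℤ → Submodule F L) (I : LieIdeal F L) (k : ℤ) : Submodule F L :=
  G k ⊓ (I.toSubmodule ⊔ below G k)

theorem lie_mem_leading (hG : ∀ i j : ℤ, ∀ x ∈ G i, ∀ y ∈ G j, ⁅x, y⁆ ∈ G (i + j))
    {I : LieIdeal F L} {j k : ℤ} {z w : L} (hz : z ∈ G j) (hw : w ∈ leading G I k) :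
    ⁅z, w⁆ ∈ leading G I (j + k) := by
  refine ⟨hG j k z hz w hw.1, ?_⟩
  obtain ⟨u, hu, f, hf, rfl⟩ := Submodule.mem_sup.1 hw.2
  rw [lie_add]
  exact add_mem (Submodule.mem_sup_left (lie_mem_right F L I z u hu))
    (Submodule.mem_sup_right (lie_mem_below hG (by omega) (le_below (lt_add_one j) hz) hf))

theorem exists_leading_ne_bot (htop : iSup G = ⊤) {I : LieIdeal F L}
    (hI : ¬ I.toSubmodule ≤ below G 0) : ∃ k : ℕ, leading G I k ≠ ⊥ := by
  obtain ⟨x, hx, hx0⟩ := SetLike.not_le_iff_exists.1 hI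
  have hex : ∃ m : ℕ, x ∈ below G m := by
    obtain ⟨k, hk⟩ := exists_mem_below htop x
    exact ⟨k.toNat, below_mono (Int.self_le_toNat k) hk⟩
  classical
  obtain ⟨m, hm⟩ : ∃ m, Nat.find hex = m + 1 :=
    Nat.exists_eq_succ_of_ne_zero fun h ↦ hx0 (by simpa [h] using Nat.find_spec hex)
  have h1 : x ∈ below G (m + 1) := by simpa [hm] using Nat.find_spec hex
  have h2 : x ∉ below G m := Nat.find_min hex (by omega)
  obtain ⟨w, hw, f, hf, rfl⟩ := Submodule.mem_sup.1 (below_add_one_le _ h1)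
  refine ⟨m, fun h ↦ h2 ?_⟩
  have h3 : w ∈ leading G I m := by
    refine ⟨hw, ?_⟩
    have := sub_mem (Submodule.mem_sup_left hx) (Submodule.mem_sup_right hf :
      f ∈ I.toSubmodule ⊔ below G m)
    rwa [add_sub_cancel_right] at this
  rw [h, Submodule.mem_bot] at h3
  rwa [h3, zero_add]

theorem leading_neg_one_ne_bot (hG : ∀ i j : ℤ, ∀ x ∈ G i, ∀ y ∈ G j, ⁅x, y⁆ ∈ G (i + j))
    (htrans : ∀ i : ℤ, 0 ≤ i → ∀ x ∈ G i, (∀ y ∈ G (-1), ⁅x, y⁆ = 0) → x = 0)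
    {I : LieIdeal F L} (k : ℕ) (hk : leading G I k ≠ ⊥) : leading G I (-1) ≠ ⊥ := by
  have step : ∀ k : ℕ, leading G I k ≠ ⊥ → leading G I (k - 1) ≠ ⊥ := by
    intro k hk hbot
    obtain ⟨w, hw, hw0⟩ := (Submodule.ne_bot_iff _).1 hk
    refine hw0 (htrans k (by omega) w hw.1 fun y hy ↦ ?_)
    have h1 := lie_mem_leading hG hy hw
    rw [neg_add_eq_sub, hbot, Submodule.mem_bot] at h1
    rw [← lie_skew, h1, neg_zero]
  induction k with
  | zero => simpa using step 0 hk
  | succ k ih => exact ih (by simpa using step (k + 1) hk)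

/-- In a transitive irreducible graded Lie algebra, an ideal which is not contained in the
negative part is not abelian. -/
theorem not_isLieAbelian (hdirect : DirectSum.IsInternal G)
    (hG : ∀ i j : ℤ, ∀ x ∈ G i, ∀ y ∈ G j, ⁅x, y⁆ ∈ G (i + j))
    (htrans : ∀ i : ℤ, 0 ≤ i → ∀ x ∈ G i, (∀ y ∈ G (-1), ⁅x, y⁆ = 0) → x = 0)
    (hirr : ∀ W : Submodule F L, W ≤ G (-1) →
      (∀ z ∈ G 0, ∀ w ∈ W, ⁅z, w⁆ ∈ W) → W = ⊥ ∨ W = G (-1))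
    {I : LieIdeal F L} (hI : ¬ I.toSubmodule ≤ below G 0) : ¬ IsLieAbelian I := by
  intro hab
  obtain ⟨k, hk⟩ := exists_leading_ne_bot hdirect.submodule_iSup_eq_top hI
  have htop : leading G I (-1) = G (-1) :=
    (hirr (leading G I (-1)) inf_le_left fun z hz w hw ↦
      zero_add (-1 : ℤ) ▸ lie_mem_leading hG hz hw).resolve_left (leading_neg_one_ne_bot hG htrans k hk)
  obtain ⟨w, hw, hw0⟩ := (Submodule.ne_bot_iff _).1 hk
  refine hw0 (htrans k (by omega) w hw.1 fun y hy ↦ ?_)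
  refine eq_zero_of_mem_below hdirect.submodule_iSupIndep (hG k (-1) w hw.1 y hy) ?_
  have hy' := htop ▸ hy
  obtain ⟨u, hu, f, hf, hufw⟩ := Submodule.mem_sup.1 hw.2
  obtain ⟨v, hv, g, hg, hvgy⟩ := Submodule.mem_sup.1 hy'.2
  have huv : ⁅u, v⁆ = 0 := congrArg Subtype.val (hab.trivial ⟨u, hu⟩ ⟨v, hv⟩)
  have h1 : ⁅w, y⁆ = ⁅f, y⁆ + ⁅w, g⁆ - ⁅f, g⁆ := by
    rw [← hufw, ← hvgy]
    simp only [add_lie, lie_add, huv]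
    abel
  rw [h1]
  have hw' : w ∈ below G (k + 1) := le_below (lt_add_one _) hw.1
  have hy'' : y ∈ below G (-1 + 1) := le_below (lt_add_one _) hy
  exact sub_mem (add_mem (lie_mem_below hG (by omega) hf hy'')
    (lie_mem_below hG (by omega) hw' hg)) (lie_mem_below hG (by omega) hf hg)

/-- A minimal ideal has no nontrivial subspaces stable under its derivations. -/
theorem eq_bot_or_eq_top_of_derivations_stable {I : LieIdeal F L}
    (hImin : ∀ J : LieIdeal F L, J ≠ ⊥ → I ≤ J) (W : Submodule F I)
    (hW : ∀ d ∈ BlockTheorem.derivations F I, ∀ w ∈ W, d w ∈ W) : W = ⊥ ∨ W = ⊤ := by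
  let adI : L → Module.End F I := fun x ↦ LieModule.toEnd F L I x
  have hadI : ∀ x, adI x ∈ BlockTheorem.derivations F I := fun x a b ↦
    Subtype.ext (leibniz_lie x (a : L) (b : L))
  let J : LieIdeal F L :=
    { W.map I.toSubmodule.subtype with
      lie_mem := by
        rintro x _ ⟨w, hw, rfl⟩
        exact ⟨adI x w, hW _ (hadI x) w hw, rfl⟩ }
  by_cases hJ : J = ⊥
  · refine Or.inl (eq_bot_iff.2 fun w hw ↦ ?_)
    have h1 : (w : L) ∈ J := ⟨w, hw, rfl⟩
    rw [hJ, LieSubmodule.mem_bot] at h1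
    exact (Submodule.mem_bot F).2 (Subtype.ext h1)
  · refine Or.inr (eq_top_iff.2 fun w _ ↦ ?_)
    obtain ⟨v, hv, hvw⟩ : (w : L) ∈ J := hImin J hJ w.2
    rwa [← (Subtype.ext hvw : v = w)]

end GradedLieAlgebra

/-- Let `F` be an algebraically closed field of characteristic `p > 0` and let
`L` be a finite-dimensional transitive irreducible `ℤ`-graded Lie algebra over `F` such that the
only ideal of `L` contained in `⊕_{i<0} Lᵢ` is zero.  Let `I` be the unique minimal ideal of `L`.
Then there exist `n ≥ 0` and a finite-dimensional simple Lie algebra `S` over `F` such that `I` is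
isomorphic, as a Lie algebra over `F`, to the current algebra `S ⊗_F O_n` (here realised as
`O_n ⊗_F S`, with bracket `[f ⊗ s, g ⊗ t] = fg ⊗ [s, t]`). -/
theorem stmt_3 {F L : Type} [Field F] [IsAlgClosed F] [LieRing L] [LieAlgebra F L]
    (p : ℕ) [CharP F p] (hp : 0 < p) [FiniteDimensional F L]
    (Lgr : ℤ → Submodule F L)
    (hdirect : DirectSum.IsInternal Lgr)
    (hbracket : ∀ i j : ℤ, ∀ x ∈ Lgr i, ∀ y ∈ Lgr j, ⁅x, y⁆ ∈ Lgr (i + j))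
    (htrans : ∀ i : ℤ, 0 ≤ i → ∀ x ∈ Lgr i, (∀ y ∈ Lgr (-1), ⁅x, y⁆ = 0) → x = 0)
    (hne : Lgr (-1) ≠ ⊥)
    (hirr : ∀ W : Submodule F L, W ≤ Lgr (-1) →
      (∀ z ∈ Lgr 0, ∀ w ∈ W, ⁅z, w⁆ ∈ W) → W = ⊥ ∨ W = Lgr (-1))
    (hgen : ∀ i : ℤ, 1 < i →
      Lgr (-i) = Submodule.span F {m | ∃ x ∈ Lgr (-1), ∃ y ∈ Lgr (-i + 1), m = ⁅x, y⁆})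
    (hrad : ∀ J : LieIdeal F L, (J : Submodule F L) ≤ ⨆ i < (0 : ℤ), Lgr i → J = ⊥)
    (I : LieIdeal F L) (hI : I ≠ ⊥) (hImin : ∀ J : LieIdeal F L, J ≠ ⊥ → I ≤ J) :
    ∃ (n : ℕ) (S : Type) (_ : LieRing S) (_ : LieAlgebra F S),
      FiniteDimensional F S ∧ LieAlgebra.IsSimple F S ∧
      ∃ e : I ≃ₗ[F] (TruncatedPolynomialAlgebra F p n ⊗[F] S),
        ∀ x y : I, e ⁅x, y⁆ = ⁅e x, e y⁆ := by
  have hprime : p.Prime := (CharP.char_is_prime_or_zero F p).resolve_right hp.ne'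
  exact BlockTheorem.exists_equiv_current p hprime
    (GradedLieAlgebra.not_isLieAbelian hdirect hbracket htrans hirr fun h ↦ hI (hrad I h))
    (GradedLieAlgebra.eq_bot_or_eq_top_of_derivations_stable hImin)
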